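/- Let 𝒯 be a one-stage tree that is not a caterpillar. Then ker φ_𝒯 contains a nonzero linear form. Specifically, if a non-leaf vertex u has two non-leaf children u_i and u_j, reached by the edges labelled θ_i and θ_j respectively, and u_{ij} denotes the child of u_i reached by the edge labelled θ_j while u_{ji} denotes the child of u_j reached by the edge labelled θ_i, then p_{[u_{ij}]} − p_{[u_{ji}]} is a nonzero element of ker φ_𝒯. -/

import Mathlib

noncomputable section
open scoped Classical
open MvPolynomial

/-- A staged tree: a finite rooted tree with edges directed away from the root,
each non-root vertex `c` carrying the label `label c` of the edge from `parent c` to `c`;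
labels of outgoing edges of a vertex are pairwise distinct, and the outgoing label sets
of two vertices are either equal (same stage) or disjoint. -/
structure StagedTree (Θ : Type) [DecidableEq Θ] : Type 1 where
  V : Type
  fintypeV : Fintype V
  decEqV : DecidableEq V
  root : V
  parent : V → V
  label : V → Θ
  parent_root : parent root = root
  reaches_root : ∀ v : V, ∃ n : ℕ, parent^[n] v = root
  label_inj : ∀ u v : V, u ≠ root → v ≠ root → parent u = parent v → label u = label v → u = v
  stage_disjoint : ∀ u v : V,
    (∀ θ : Θ, (∃ c, c ≠ root ∧ parent c = u ∧ label c = θ) ↔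
        (∃ c, c ≠ root ∧ parent c = v ∧ label c = θ)) ∨
    (∀ θ : Θ, ¬((∃ c, c ≠ root ∧ parent c = u ∧ label c = θ) ∧
        (∃ c, c ≠ root ∧ parent c = v ∧ label c = θ)))

namespace StagedTree

attribute [instance] StagedTree.fintypeV StagedTree.decEqV

variable {Θ : Type} [DecidableEq Θ] (T : StagedTree Θ)

/-- `c` is a child of `v`. -/
def IsChild (v c : T.V) : Prop := c ≠ T.root ∧ T.parent c = v

/-- `v` is a leaf (no children). -/
def IsLeaf (v : T.V) : Prop := ∀ c, ¬ T.IsChild v c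

/-- `w` lies in the subtree rooted at `v` (i.e. `v` is an ancestor of `w` or `w` itself). -/
def Desc (v w : T.V) : Prop := ∃ n : ℕ, T.parent^[n] w = v

/-- Distance of `v` from the root. -/
def depthOf (v : T.V) : ℕ := Nat.find (T.reaches_root v)

/-- The depth `d` of the tree: maximal number of edges on a root-to-leaf path. -/
def depth : ℕ := Finset.univ.sup T.depthOf

/-- The type of leaves of `T`. -/
def Leaf : Type := {v : T.V // T.IsLeaf v}

instance : Fintype T.Leaf := Subtype.fintype _

/-- Product of the labels along the root-to-`v` path, in `ℝ[Θ]`. -/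
def pathProd (v : T.V) : MvPolynomial Θ ℝ :=
  ∏ i ∈ Finset.range (T.depthOf v), X (T.label (T.parent^[i] v))

/-- Homogenised root-to-`v` path monomial `z^(d - d(λ)) ∏ θ(e)` in `ℝ[Θ, z]`,
where the variable `none` plays the role of `z`. -/
def hpm (v : T.V) : MvPolynomial (Option Θ) ℝ :=
  (X none) ^ (T.depth - T.depthOf v) *
    ∏ i ∈ Finset.range (T.depthOf v), X (some (T.label (T.parent^[i] v)))

/-- The ideal `⟨θ - z⟩` of homogenised local sum-to-one conditions. -/
def sumIdeal : Ideal (MvPolynomial (Option Θ) ℝ) :=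
  Ideal.span {f | ∃ v : T.V, ¬ T.IsLeaf v ∧
    f = (∑ c ∈ Finset.univ.filter (fun c => T.IsChild v c), X (some (T.label c))) - X none}

/-- The homogenised parametrisation `φ_T : ℝ[p] → ℝ[Θ, z]/⟨θ - z⟩`. -/
def phi : MvPolynomial T.Leaf ℝ →ₐ[ℝ] MvPolynomial (Option Θ) ℝ ⧸ T.sumIdeal :=
  aeval (fun l : T.Leaf => Ideal.Quotient.mk T.sumIdeal (T.hpm l.1))

/-- The ideal `⟨θ - 1⟩` of local sum-to-one conditions. -/
def oneIdeal : Ideal (MvPolynomial Θ ℝ) :=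
  Ideal.span {f | ∃ v : T.V, ¬ T.IsLeaf v ∧
    f = (∑ c ∈ Finset.univ.filter (fun c => T.IsChild v c), X (T.label c)) - 1}

/-- The (non-homogenised) parametrisation `φ_T : ℝ[p] → ℝ[Θ]/⟨θ - 1⟩`. -/
def phi1 : MvPolynomial T.Leaf ℝ →ₐ[ℝ] MvPolynomial Θ ℝ ⧸ T.oneIdeal :=
  aeval (fun l : T.Leaf => Ideal.Quotient.mk T.oneIdeal (T.pathProd l.1))

/-- The subtree polynomial `t(v)`: sum over all `v`-to-leaf paths of the products of
edge labels along the path. -/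
def tpoly (v : T.V) : MvPolynomial Θ ℝ :=
  ∑ l ∈ Finset.univ.filter (fun w => T.IsLeaf w ∧ T.Desc v w),
    ∏ i ∈ Finset.range (T.depthOf l - T.depthOf v), X (T.label (T.parent^[i] l))

/-- Two non-leaf vertices are in the same stage when their outgoing label sets coincide. -/
def SameStage (u v : T.V) : Prop :=
  ¬ T.IsLeaf u ∧ ¬ T.IsLeaf v ∧
    ∀ θ : Θ, (∃ c, T.IsChild u c ∧ T.label c = θ) ↔ (∃ c, T.IsChild v c ∧ T.label c = θ)

/-- `T` is balanced: `t(u_i)·t(v_j) = t(u_j)·t(v_i)` for all `u ∼ v` and all pairs of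
children matched via the common labels. -/
def Balanced : Prop :=
  ∀ u v ui uj vi vj : T.V, T.SameStage u v →
    T.IsChild u ui → T.IsChild u uj → T.IsChild v vi → T.IsChild v vj →
    T.label ui = T.label vi → T.label uj = T.label vj →
    T.tpoly ui * T.tpoly vj = T.tpoly uj * T.tpoly vi

/-- `p_{[v]}`: sum of the variables `p_r` over root-to-leaf paths through `v`. -/
def pSum (v : T.V) : MvPolynomial T.Leaf ℝ :=
  ∑ l ∈ Finset.univ.filter (fun l : T.Leaf => T.Desc v l.1), X l

/-- `T` has toric structure: there are linearly independent linear forms in which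
`ker φ_T` is generated by binomials. -/
def Toric : Prop :=
  ∃ L : T.Leaf → MvPolynomial T.Leaf ℝ,
    (∀ i, (L i).IsHomogeneous 1) ∧ LinearIndependent ℝ L ∧
    ∃ B : Set (MvPolynomial T.Leaf ℝ),
      (∀ f ∈ B, ∃ a b : T.Leaf → ℕ, f = (∏ i, L i ^ a i) - (∏ i, L i ^ b i)) ∧
      RingHom.ker T.phi.toRingHom = Ideal.span B

end StagedTree

namespace StagedTree

variable {Θ : Type} [DecidableEq Θ] (T : StagedTree Θ)

variable {T} in
theorem depthOf_eq_zero_iff {v : T.V} : T.depthOf v = 0 ↔ v = T.root := by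
  simp [depthOf, Nat.find_eq_zero]

variable {T} in
theorem IsChild.depthOf {v c : T.V} (h : T.IsChild v c) : T.depthOf c = T.depthOf v + 1 := by
  obtain ⟨hc, rfl⟩ := h
  exact Nat.find_comp_succ (T.reaches_root c) (T.reaches_root (T.parent c)) hc

theorem isChild_parent {v : T.V} (h : v ≠ T.root) : T.IsChild (T.parent v) v := ⟨h, rfl⟩

variable {T} in
theorem IsChild.not_isLeaf {v c : T.V} (h : T.IsChild v c) : ¬ T.IsLeaf v := fun hl => hl c h

theorem depthOf_le_depth (v : T.V) : T.depthOf v ≤ T.depth :=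
  Finset.le_sup (f := T.depthOf) (Finset.mem_univ v)

/-- Induction from the leaves towards the root. -/
theorem induction_of_children {P : T.V → Prop}
    (h : ∀ v, (∀ c, T.IsChild v c → P c) → P v) (v : T.V) : P v := by
  induction hn : T.depth - T.depthOf v using Nat.strong_induction_on generalizing v with
  | _ n ih =>
    refine h v fun c hc => ih _ ?_ c rfl
    have := hc.depthOf
    have := T.depthOf_le_depth c
    omega

theorem Desc.refl (v : T.V) : T.Desc v v := ⟨0, rfl⟩

variable {T} in
theorem IsChild.desc {v c w : T.V} (h : T.IsChild v c) (hw : T.Desc c w) : T.Desc v w := by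
  obtain ⟨n, rfl⟩ := hw
  exact ⟨n + 1, by rw [Function.iterate_succ_apply']; exact h.2⟩

theorem desc_iff {v w : T.V} : T.Desc v w ↔ w = v ∨ ∃ c, T.IsChild v c ∧ T.Desc c w := by
  constructor
  · rintro ⟨n, hn⟩
    induction n with
    | zero => exact Or.inl hn
    | succ n ih =>
      rw [Function.iterate_succ_apply'] at hn
      by_cases hr : T.parent^[n] w = T.root
      · exact ih (by rw [← hn, hr, T.parent_root])
      · exact Or.inr ⟨_, ⟨hr, hn⟩, n, rfl⟩
  · rintro (rfl | ⟨c, hc, hw⟩)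
    · exact Desc.refl T w
    · exact hc.desc hw

theorem depthOf_iterate (n : ℕ) (w : T.V) :
    T.depthOf (T.parent^[n] w) = T.depthOf w - n := by
  induction n with
  | zero => rfl
  | succ n ih =>
    rw [Function.iterate_succ_apply']
    by_cases hr : T.parent^[n] w = T.root
    · rw [hr, T.parent_root, ← hr, ih]
      have := depthOf_eq_zero_iff.2 hr
      omega
    · have := (T.isChild_parent hr).depthOf
      omega

/-- Two ancestors of the same vertex at equal depth coincide. -/
theorem Desc.eq_of_depthOf_eq {v v' w : T.V} (h : T.Desc v w) (h' : T.Desc v' w)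
    (hd : T.depthOf v = T.depthOf v') : v = v' := by
  obtain ⟨n, rfl⟩ := h
  obtain ⟨m, rfl⟩ := h'
  by_cases hr : T.parent^[n] w = T.root
  · have h0 := depthOf_eq_zero_iff.2 hr
    exact hr.trans (depthOf_eq_zero_iff.1 (hd ▸ h0)).symm
  · have h0 := mt depthOf_eq_zero_iff.1 hr
    rw [depthOf_iterate] at h0
    rw [depthOf_iterate, depthOf_iterate] at hd
    rw [show n = m by omega]

theorem exists_leaf_desc (v : T.V) : ∃ l : T.Leaf, T.Desc v l.1 := by
  induction v using T.induction_of_children with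
  | h v ih =>
    by_cases hv : T.IsLeaf v
    · exact ⟨⟨v, hv⟩, Desc.refl T v⟩
    · simp only [IsLeaf, not_forall, not_not] at hv
      obtain ⟨c, hc⟩ := hv
      obtain ⟨l, hl⟩ := ih c hc
      exact ⟨l, hc.desc hl⟩

variable {T} in
theorem IsChild.pathProd {v c : T.V} (h : T.IsChild v c) :
    T.pathProd c = T.pathProd v * X (T.label c) := by
  simp only [StagedTree.pathProd, h.depthOf, Finset.prod_range_succ',
    Function.iterate_succ_apply, h.2, Function.iterate_zero, id]

theorem pSum_leaf (l : T.Leaf) : T.pSum l.1 = X l := by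
  have : (Finset.univ.filter fun l' : T.Leaf => T.Desc l.1 l'.1) = {l} := by
    ext l'
    rw [Finset.mem_filter_univ, Finset.mem_singleton, desc_iff]
    constructor
    · rintro (hl | ⟨c, hc, -⟩)
      · exact Subtype.ext hl
      · exact absurd hc (l.2 c)
    · rintro rfl
      exact Or.inl rfl
  rw [pSum, this, Finset.sum_singleton]

theorem pSum_of_not_isLeaf {v : T.V} (h : ¬ T.IsLeaf v) :
    T.pSum v = ∑ c ∈ Finset.univ.filter (fun c => T.IsChild v c), T.pSum c := by
  have : (Finset.univ.filter fun l : T.Leaf => T.Desc v l.1) =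
      (Finset.univ.filter fun c => T.IsChild v c).biUnion
        fun c => Finset.univ.filter fun l : T.Leaf => T.Desc c l.1 := by
    ext l
    simp only [Finset.mem_filter, Finset.mem_univ, true_and, Finset.mem_biUnion]
    rw [desc_iff, or_iff_right]
    rintro hl
    exact h (hl ▸ l.2)
  rw [pSum, this, Finset.sum_biUnion]
  · rfl
  · intro c hc c' hc' hne
    simp only [Finset.coe_filter, Finset.mem_univ, true_and, Set.mem_ofPred_eq] at hc hc'
    refine Finset.disjoint_left.2 fun l hl hl' => hne ?_
    simp only [Finset.mem_filter, Finset.mem_univ, true_and] at hl hl'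
    exact Desc.eq_of_depthOf_eq T hl hl' (by rw [hc.depthOf, hc'.depthOf])

theorem phi1_pSum (v : T.V) : T.phi1 (T.pSum v) = Ideal.Quotient.mk T.oneIdeal (T.pathProd v) := by
  induction v using T.induction_of_children with
  | h v ih =>
    by_cases hv : T.IsLeaf v
    · exact (congrArg T.phi1 (T.pSum_leaf ⟨v, hv⟩)).trans (aeval_X _ _)
    · have hchild : ∀ c ∈ Finset.univ.filter (fun c => T.IsChild v c), T.phi1 (T.pSum c) =
          Ideal.Quotient.mk T.oneIdeal (T.pathProd v * X (T.label c)) := fun c hc => by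
        have hc := (Finset.mem_filter.1 hc).2
        rw [ih c hc, hc.pathProd]
      rw [T.pSum_of_not_isLeaf hv, map_sum, Finset.sum_congr rfl hchild, ← map_sum,
        ← Finset.mul_sum, Ideal.Quotient.eq]
      have hmem : (∑ c ∈ Finset.univ.filter (fun c => T.IsChild v c), X (T.label c)) - 1 ∈
          T.oneIdeal := Ideal.subset_span ⟨v, hv, rfl⟩
      simpa [mul_sub] using T.oneIdeal.mul_mem_left (T.pathProd v) hmem

theorem pSum_isHomogeneous (v : T.V) : (T.pSum v).IsHomogeneous 1 :=
  IsHomogeneous.sum _ _ _ fun l _ => isHomogeneous_X ℝ l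

theorem eval_single_pSum (v : T.V) (l : T.Leaf) :
    eval (Pi.single l 1) (T.pSum v) = if T.Desc v l.1 then 1 else 0 := by
  simp [pSum, Pi.single_apply]

theorem pSum_sub_pSum_ne_zero {v w : T.V} (hd : T.depthOf v = T.depthOf w) (hne : v ≠ w) :
    T.pSum v - T.pSum w ≠ 0 := by
  obtain ⟨l, hl⟩ := T.exists_leaf_desc v
  intro h
  have hw : ¬ T.Desc w l.1 := fun hw => hne (Desc.eq_of_depthOf_eq T hl hw hd)
  have := congrArg (eval (Pi.single l 1)) h
  simp [eval_single_pSum, hl, hw] at this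

/-- Swapping two labels of consecutive edges below `u` gives a linear relation. -/
theorem pSum_sub_pSum_mem_ker {u ui uj uij uji : T.V}
    (hi : T.IsChild u ui) (hj : T.IsChild u uj) (hij : T.IsChild ui uij) (hji : T.IsChild uj uji)
    (hlij : T.label uij = T.label uj) (hlji : T.label uji = T.label ui) :
    T.pSum uij - T.pSum uji ∈ RingHom.ker T.phi1.toRingHom := by
  have : T.phi1 (T.pSum uij - T.pSum uji) = 0 := by
    rw [map_sub, phi1_pSum, phi1_pSum, hij.pathProd, hji.pathProd, hi.pathProd, hj.pathProd,
      hlij, hlji, mul_right_comm, sub_self]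
  exact this

/-- Two distinct non-leaf vertices at equal depth force two distinct non-leaf siblings. -/
theorem exists_not_isLeaf_siblings {v w : T.V} (hv : ¬ T.IsLeaf v) (hw : ¬ T.IsLeaf w)
    (hne : v ≠ w) (hd : T.depthOf v = T.depthOf w) :
    ∃ u ui uj, ¬ T.IsLeaf ui ∧ ¬ T.IsLeaf uj ∧ ui ≠ uj ∧ T.IsChild u ui ∧ T.IsChild u uj := by
  induction hn : T.depthOf v generalizing v w with
  | zero =>
    exact absurd ((depthOf_eq_zero_iff.1 hn).trans (depthOf_eq_zero_iff.1 (hd ▸ hn)).symm) hne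
  | succ n ih =>
    have hvc := T.isChild_parent (mt (depthOf_eq_zero_iff (v := v)).2 (by omega))
    have hwc := T.isChild_parent (mt (depthOf_eq_zero_iff (v := w)).2 (by omega))
    by_cases hp : T.parent v = T.parent w
    · exact ⟨_, v, w, hv, hw, hne, hvc, hp ▸ hwc⟩
    · have := hvc.depthOf
      have := hwc.depthOf
      exact ih hvc.not_isLeaf hwc.not_isLeaf hp (by omega) (by omega)

/-- A one-stage tree which is not a caterpillar has a nonzero linear
form in `ker φ_𝒯`. Specifically, if a non-leaf vertex `u` has two non-leaf children
`u_i ≠ u_j` (reached by distinct labels `θ_i`, `θ_j`), `u_{ij}` is the child of `u_i`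
labelled `θ_j` and `u_{ji}` the child of `u_j` labelled `θ_i`, then
`p_{[u_{ij}]} − p_{[u_{ji}]}` is a nonzero element of `ker φ_𝒯`. -/
theorem oneStage_not_caterpillar_linear_relation
    (honestage : ∀ u v : T.V, ¬ T.IsLeaf u → ¬ T.IsLeaf v → T.SameStage u v)
    (hnotcat : ∃ u v : T.V, ¬ T.IsLeaf u ∧ ¬ T.IsLeaf v ∧ u ≠ v ∧ T.depthOf u = T.depthOf v) :
    (∃ f : MvPolynomial T.Leaf ℝ, f ≠ 0 ∧ f.IsHomogeneous 1 ∧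
        f ∈ RingHom.ker T.phi1.toRingHom) ∧
    (∀ u ui uj uij uji : T.V, ¬ T.IsLeaf ui → ¬ T.IsLeaf uj →
      T.IsChild u ui → T.IsChild u uj → T.label ui ≠ T.label uj →
      T.IsChild ui uij → T.IsChild uj uji →
      T.label uij = T.label uj → T.label uji = T.label ui →
      T.pSum uij - T.pSum uji ≠ 0 ∧
        T.pSum uij - T.pSum uji ∈ RingHom.ker T.phi1.toRingHom) := by
  have key : ∀ u ui uj uij uji : T.V, ¬ T.IsLeaf ui → ¬ T.IsLeaf uj →
      T.IsChild u ui → T.IsChild u uj → T.label ui ≠ T.label uj →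
      T.IsChild ui uij → T.IsChild uj uji →
      T.label uij = T.label uj → T.label uji = T.label ui →
      T.pSum uij - T.pSum uji ≠ 0 ∧
        T.pSum uij - T.pSum uji ∈ RingHom.ker T.phi1.toRingHom := by
    intro u ui uj uij uji _ _ hi hj hl hij hji hlij hlji
    refine ⟨T.pSum_sub_pSum_ne_zero ?_ ?_, T.pSum_sub_pSum_mem_ker hi hj hij hji hlij hlji⟩
    · rw [hij.depthOf, hji.depthOf, hi.depthOf, hj.depthOf]
    · rintro rfl
      exact hl (hlji.symm.trans hlij)
  refine ⟨?_, key⟩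
  obtain ⟨v, w, hv, hw, hne, hd⟩ := hnotcat
  obtain ⟨u, ui, uj, hui, huj, hne, hi, hj⟩ := T.exists_not_isLeaf_siblings hv hw hne hd
  have hl : T.label ui ≠ T.label uj := fun h =>
    hne (T.label_inj ui uj hi.1 hj.1 (hi.2.trans hj.2.symm) h)
  obtain ⟨uij, hij, hlij⟩ := ((honestage u ui hi.not_isLeaf hui).2.2 _).1 ⟨uj, hj, rfl⟩
  obtain ⟨uji, hji, hlji⟩ := ((honestage u uj hi.not_isLeaf huj).2.2 _).1 ⟨ui, hi, rfl⟩
  obtain ⟨h0, hker⟩ := key u ui uj uij uji hui huj hi hj hl hij hji hlij hlji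
  exact ⟨_, h0, (T.pSum_isHomogeneous uij).sub (T.pSum_isHomogeneous uji), hker⟩

end StagedTree
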